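/- arXiv:2407.20304 — 2 statements merged into one kernel-verified Lean document; each statement's English description precedes it below -/
import Mathlib

section
/- (Fresnel scaling theorem, exact form.) Let λ > 0, z₁ > 0, z₂ > 0, set k = 2π/λ, Z = z₁ + z₂, m = Z/z₁, and ζ = z₁z₂/Z. Let ψ : ℝ² → ℂ be (Lebesgue) integrable. Then for every x ∈ ℝ²: 𝒫_{z₂}( w ↦ exp(iπ‖w‖²/(λz₁)) ψ(w) )(x) = e^{ik(z₂ − ζ)} · (exp(iπ‖x‖²/(λZ))/m) · 𝒫_{ζ}(ψ)(x/m). In particular, both convolution integrals converge absolutely for every x. -/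
open MeasureTheory Real

noncomputable section

/-- The plane ℝ² with the Euclidean norm. -/
abbrev Plane := EuclideanSpace ℝ (Fin 2)

/-- The Fresnel kernel `P_Z(x) = (e^{ikZ}/(iλZ)) exp(iπ‖x‖²/(λZ))` with `k = 2π/λ`. -/
def fresnelKernel (lam Z : ℝ) (x : Plane) : ℂ :=
  (Complex.exp ((2 * π / lam * Z : ℝ) * Complex.I) / (Complex.I * (lam : ℂ) * (Z : ℂ))) *
    Complex.exp ((π * ‖x‖ ^ 2 / (lam * Z) : ℝ) * Complex.I)

/-- The Fresnel propagator: convolution with the Fresnel kernel. -/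
def fresnelProp (lam Z : ℝ) (ψ : Plane → ℂ) (x : Plane) : ℂ :=
  ∫ w, ψ w * fresnelKernel lam Z (x - w)

@[fun_prop]
theorem continuous_fresnelKernel (lam Z : ℝ) : Continuous (fresnelKernel lam Z) := by
  unfold fresnelKernel
  fun_prop

theorem norm_fresnelKernel (lam Z : ℝ) (x : Plane) :
    ‖fresnelKernel lam Z x‖ = (|lam| * |Z|)⁻¹ := by
  simp [fresnelKernel, -Complex.ofReal_mul, -Complex.ofReal_div, -Complex.ofReal_pow,
    mul_comm]

/-- The Fresnel convolution integral of an integrable function converges absolutely everywhere. -/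
theorem integrable_mul_fresnelKernel (lam Z : ℝ) {ψ : Plane → ℂ} (hψ : Integrable ψ) (x : Plane) :
    Integrable (fun w => ψ w * fresnelKernel lam Z (x - w)) :=
  hψ.mul_bdd (c := (|lam| * |Z|)⁻¹)
    (by fun_prop : Continuous fun w => fresnelKernel lam Z (x - w)).aestronglyMeasurable
    (.of_forall fun w => (norm_fresnelKernel lam Z (x - w)).le)

/-- Modulating by a quadratic phase preserves integrability. -/
theorem integrable_quadraticPhase_mul (lam z : ℝ) {ψ : Plane → ℂ} (hψ : Integrable ψ) :
    Integrable (fun w : Plane =>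
      Complex.exp ((π * ‖w‖ ^ 2 / (lam * z) : ℝ) * Complex.I) * ψ w) :=
  hψ.bdd_mul (c := 1)
    (by fun_prop : Continuous fun w : Plane =>
      Complex.exp ((π * ‖w‖ ^ 2 / (lam * z) : ℝ) * Complex.I)).aestronglyMeasurable
    (.of_forall fun _ => (Complex.norm_exp_ofReal_mul_I _).le)

/-- Completing the square in the combined phase of a spherical wave and its propagation. -/
theorem norm_sq_div_add_norm_sub_sq_div {E : Type*} [NormedAddCommGroup E] [InnerProductSpace ℝ E]
    {a b : ℝ} (ha : a ≠ 0) (hb : b ≠ 0) (hab : a + b ≠ 0) (w x : E) :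
    ‖w‖ ^ 2 / a + ‖x - w‖ ^ 2 / b =
      ‖x‖ ^ 2 / (a + b) + ‖(a / (a + b)) • x - w‖ ^ 2 / (a * b / (a + b)) := by
  rw [norm_sub_sq_real, norm_sub_sq_real, norm_smul, inner_smul_left, mul_pow, Real.norm_eq_abs,
    sq_abs]
  simp only [conj_trivial]
  field_simp
  ring

/-- The pointwise identity between the Fresnel kernels of the conic and parallel-beam geometries. -/
theorem quadraticPhase_mul_fresnelKernel (lam : ℝ) {a b : ℝ} (ha : a ≠ 0) (hb : b ≠ 0)
    (hab : a + b ≠ 0) (w x : Plane) :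
    Complex.exp ((π * ‖w‖ ^ 2 / (lam * a) : ℝ) * Complex.I) * fresnelKernel lam b (x - w) =
      Complex.exp ((2 * π / lam * (b - a * b / (a + b)) : ℝ) * Complex.I) *
        (Complex.exp ((π * ‖x‖ ^ 2 / (lam * (a + b)) : ℝ) * Complex.I) /
          (((a + b) / a : ℝ) : ℂ)) *
        fresnelKernel lam (a * b / (a + b)) ((a / (a + b)) • x - w) := by
  have hphase : 2 * π / lam * b + (π * ‖w‖ ^ 2 / (lam * a) + π * ‖x - w‖ ^ 2 / (lam * b)) =
      2 * π / lam * (b - a * b / (a + b)) + π * ‖x‖ ^ 2 / (lam * (a + b)) +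
        (2 * π / lam * (a * b / (a + b)) +
          π * ‖(a / (a + b)) • x - w‖ ^ 2 / (lam * (a * b / (a + b)))) := by
    have h := norm_sq_div_add_norm_sub_sq_div ha hb hab w x
    simp only [mul_div_mul_comm]
    linear_combination π / lam * h
  have hexp := congrArg (fun t : ℝ => Complex.exp (t * Complex.I)) hphase
  simp only [Complex.ofReal_add, add_mul, Complex.exp_add] at hexp
  have hamp : (Complex.I * lam * b)⁻¹ =
      ((((a + b) / a : ℝ) : ℂ))⁻¹ * (Complex.I * lam * ((a * b / (a + b) : ℝ) : ℂ))⁻¹ := by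
    have ha' : (a : ℂ) ≠ 0 := mod_cast ha
    have hab' : (a : ℂ) + b ≠ 0 := mod_cast hab
    push_cast
    rw [← mul_inv]
    congr 1
    field_simp
  simp only [fresnelKernel, div_eq_mul_inv (Complex.exp _)]
  rw [hamp]
  linear_combination ((((a + b) / a : ℝ) : ℂ))⁻¹ *
    (Complex.I * lam * ((a * b / (a + b) : ℝ) : ℂ))⁻¹ * hexp

/-- The Fresnel scaling theorem, exact form: a spherical illumination of curvature `z₁`
modulated by an integrable `ψ` and propagated a distance `z₂` equals, up to the explicit
unimodular factor `e^{ik(z₂-ζ)}` and the detector-plane quadratic phase, the parallel-beam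
propagation of `ψ` over the effective distance `ζ = z₁z₂/Z` at the demagnified coordinate
`x/m`.  Both convolution integrals converge absolutely for every `x`. -/
theorem fresnel_scaling (lam z₁ z₂ k Z m ζ : ℝ) (hlam : 0 < lam)
    (h1 : 0 < z₁) (h2 : 0 < z₂) (hk : k = 2 * π / lam) (hZ : Z = z₁ + z₂)
    (hm : m = Z / z₁) (hζ : ζ = z₁ * z₂ / Z)
    (ψ : Plane → ℂ) (hψ : Integrable ψ) (x : Plane) :
    Integrable (fun w =>
      (Complex.exp ((π * ‖w‖ ^ 2 / (lam * z₁) : ℝ) * Complex.I) * ψ w) *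
        fresnelKernel lam z₂ (x - w)) ∧
    Integrable (fun w => ψ w * fresnelKernel lam ζ ((1 / m) • x - w)) ∧
    fresnelProp lam z₂
        (fun w => Complex.exp ((π * ‖w‖ ^ 2 / (lam * z₁) : ℝ) * Complex.I) * ψ w) x =
      Complex.exp ((k * (z₂ - ζ) : ℝ) * Complex.I) *
        (Complex.exp ((π * ‖x‖ ^ 2 / (lam * Z) : ℝ) * Complex.I) / (m : ℂ)) *
        fresnelProp lam ζ ψ ((1 / m) • x) := by
  refine ⟨integrable_mul_fresnelKernel lam z₂ (integrable_quadraticPhase_mul lam z₁ hψ) x,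
    integrable_mul_fresnelKernel lam ζ hψ _, ?_⟩
  subst hk hZ hm hζ
  rw [one_div_div]
  unfold fresnelProp
  rw [← integral_const_mul]
  congr with w
  linear_combination ψ w *
    quadraticPhase_mul_fresnelKernel lam h1.ne' h2.ne' (add_pos h1 h2).ne' w x
end
end

section
/- (Commutation of magnification and Fresnel propagation, exact form.) Let λ > 0 with k = 2π/λ, let m > 0 and ζ ≠ 0 be real, and let ψ : ℝ² → ℂ be integrable. Then for every x ∈ ℝ²: 𝒫_{ζ}(ψ)(x/m) = e^{ikζ(1 − m²)} · 𝒫_{ζm²}(ℳ_m ψ)(x), where ℳ_m ψ(x) = ψ(x/m). Equivalently, ℳ_m ∘ 𝒫_ζ = e^{ikζ(1−m²)} · 𝒫_{ζm²} ∘ ℳ_m on integrable functions. -/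
open MeasureTheory Real

noncomputable section

/-- The magnification (dilation) operator `ℳ_m ψ(x) = ψ(x/m)`. -/
def mag (m : ℝ) (ψ : Plane → ℂ) (x : Plane) : ℂ := ψ ((1 / m) • x)

/-- Scaling the argument of the Fresnel kernel by `1/m` rescales the distance by `m²`. -/
lemma fresnelKernel_smul {lam m ζ : ℝ} (hm : m ≠ 0) (y : Plane) :
    fresnelKernel lam ζ ((1 / m) • y) =
      (m : ℂ) ^ 2 * (Complex.exp ((2 * π / lam * ζ * (1 - m ^ 2) : ℝ) * Complex.I) *
        fresnelKernel lam (ζ * m ^ 2) y) := by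
  have hnorm : π * ‖(1 / m) • y‖ ^ 2 / (lam * ζ) = π * ‖y‖ ^ 2 / (lam * (ζ * m ^ 2)) := by
    rw [norm_smul, mul_pow, Real.norm_eq_abs, sq_abs]
    field_simp
  have hexp : Complex.exp ((2 * π / lam * ζ : ℝ) * Complex.I) =
      Complex.exp ((2 * π / lam * ζ * (1 - m ^ 2) : ℝ) * Complex.I) *
        Complex.exp ((2 * π / lam * (ζ * m ^ 2) : ℝ) * Complex.I) := by
    rw [← Complex.exp_add]
    congr 1
    push_cast
    ring
  have hmC : (m : ℂ) ≠ 0 := Complex.ofReal_ne_zero.mpr hm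
  unfold fresnelKernel
  rw [hnorm, hexp, Complex.ofReal_mul ζ, Complex.ofReal_pow]
  field_simp

/-- Commutation of magnification and Fresnel propagation, exact form:
`𝒫_ζ(ψ)(x/m) = e^{ikζ(1-m²)} 𝒫_{ζm²}(ℳ_m ψ)(x)`. -/
theorem mag_fresnel_comm (lam k m ζ : ℝ) (hlam : 0 < lam) (hk : k = 2 * π / lam)
    (hm : 0 < m) (hζ : ζ ≠ 0) (ψ : Plane → ℂ) (hψ : Integrable ψ) (x : Plane) :
    fresnelProp lam ζ ψ ((1 / m) • x) =
      Complex.exp ((k * ζ * (1 - m ^ 2) : ℝ) * Complex.I) *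
        fresnelProp lam (ζ * m ^ 2) (mag m ψ) x := by
  subst hk
  have hscale := Measure.integral_comp_smul_of_nonneg (volume : Measure Plane)
    (fun w => ψ w * fresnelKernel lam ζ ((1 / m) • x - w)) (1 / m) (hR := by positivity)
  have hmC : (m : ℂ) ≠ 0 := Complex.ofReal_ne_zero.mpr hm.ne'
  simp_rw [← smul_sub, fresnelKernel_smul hm.ne', mul_left_comm (ψ _), integral_const_mul]
    at hscale
  rw [finrank_euclideanSpace_fin, one_div_pow, one_div (m ^ 2), inv_inv, Complex.real_smul,
    Complex.ofReal_pow] at hscale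
  exact (mul_left_cancel₀ (pow_ne_zero 2 hmC) hscale).symm
end
end
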